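/- arXiv:1603.08616 — 3 statements merged into one kernel-verified Lean document; each statement's English description precedes it below -/
import Mathlib

section
/- (Proposition 1: the greedy affine function is a lower bound.) Let F : 2^[N] → ℝ be a normalized submodular set function. Let v_1, …, v_N be an enumeration of [N] constructed greedily as follows: V_1 = ∅, and for each j = 1, …, N, the element v_j ∈ [N] \ V_j satisfies F(V_j ∪ {v_j}) − F(V_j) = max_{k ∈ [N] \ V_j} (F(V_j ∪ {k}) − F(V_j)), where V_{j+1} = V_j ∪ {v_j}; set the weight s^g_{v_j} = F(V_j ∪ {v_j}) − F(V_j). Then the modular function s^g with these weights satisfies s^g(X) = Σ_{i∈X} s^g_i ≤ F(X) for every X ⊆ [N]. -/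
/-- The marginal gains of a normalized submodular function along an injective enumeration
sum to at most its value, on the image of any finite set of indices. -/
theorem sum_marginal_le_of_submodular {ι α : Type*} [LinearOrder ι] [Fintype ι] [DecidableEq α]
    (F : Finset α → ℝ) (hnorm : F ∅ = 0)
    (hsub : ∀ X Y : Finset α, F (X ∩ Y) + F (X ∪ Y) ≤ F X + F Y)
    (v : ι → α) (hv : Function.Injective v) (V : ι → Finset α)
    (hV : ∀ j, V j = (Finset.univ.filter (fun k => k < j)).image v) (T : Finset ι) :
    ∑ j ∈ T, (F (insert (v j) (V j)) - F (V j)) ≤ F (T.image v) := by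
  induction T using Finset.induction_on_max with
  | empty => simp [hnorm]
  | insert a T hlt ih =>
    have ha : a ∉ T := fun h => lt_irrefl a (hlt a h)
    have hT : T.image v ⊆ V a := by
      rw [hV]
      exact Finset.image_subset_image fun x hx => by simpa using hlt x hx
    have hva : v a ∉ V a := by simp [hV, hv.eq_iff]
    have h := hsub (insert (v a) (T.image v)) (V a)
    rw [Finset.insert_inter_of_notMem hva, Finset.inter_eq_left.mpr hT, Finset.insert_union,
      Finset.union_eq_right.mpr hT] at h
    rw [Finset.sum_insert ha, Finset.image_insert]
    linarith

/-- Proposition 1: the greedy affine function is a lower bound on a normalized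
submodular function. -/
theorem greedy_modular_lower_bound
    (N : ℕ)
    (F : Finset (Fin N) → ℝ)
    (hnorm : F ∅ = 0)
    (hsub : ∀ X Y : Finset (Fin N), F (X ∩ Y) + F (X ∪ Y) ≤ F X + F Y)
    (v : Fin N → Fin N) (hv : Function.Bijective v)
    (V : Fin N → Finset (Fin N))
    (hV : ∀ j : Fin N, V j = (Finset.univ.filter (fun k : Fin N => k < j)).image v)
    (hgreedy : ∀ j : Fin N, ∀ k ∉ V j,
      F (insert k (V j)) - F (V j) ≤ F (insert (v j) (V j)) - F (V j))
    (s : Fin N → ℝ)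
    (hs : ∀ j : Fin N, s (v j) = F (insert (v j) (V j)) - F (V j)) :
    ∀ X : Finset (Fin N), (∑ i ∈ X, s i) ≤ F X := by
  intro X
  obtain ⟨T, rfl⟩ : ∃ T : Finset (Fin N), T.image v = X :=
    ⟨Finset.univ.filter (fun j => v j ∈ X), by
      ext x
      obtain ⟨j, rfl⟩ := hv.2 x
      simp [hv.1.eq_iff]⟩
  rw [Finset.sum_image hv.1.injOn, Finset.sum_congr rfl fun j _ => hs j]
  exact sum_marginal_le_of_submodular F hnorm hsub v hv.1 V hV T
end

section
/- (Proposition 2, shrink supergradient.) Let F : 2^[N] → ℝ be a normalized submodular set function and let X ⊆ [N]. Define the modular function š_X by the weights š_X({j}) = F(X) − F(X \ {j}) for j ∈ X, and š_X({j}) = F({j}) for j ∉ X. Then š_X is a supergradient of F at X; that is, F(Y) ≤ F(X) + š_X(Y) − š_X(X) for every Y ⊆ [N]. -/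
theorem submodular_union_le_add_sum_singleton {α : Type*} [DecidableEq α]
    {F : Finset α → ℝ} (hnorm : F ∅ = 0)
    (hsub : ∀ X Y : Finset α, F (X ∩ Y) + F (X ∪ Y) ≤ F X + F Y)
    {A B : Finset α} (hAB : Disjoint A B) :
    F (A ∪ B) ≤ F A + ∑ j ∈ B, F {j} := by
  induction B using Finset.induction_on with
  | empty => simp
  | insert j B hj ih =>
    obtain ⟨hjA, hAB⟩ := Finset.disjoint_insert_right.mp hAB
    have h := hsub (A ∪ B) {j}
    have h_inter : (A ∪ B) ∩ {j} = ∅ := by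
      rw [Finset.inter_singleton_of_notMem (by simp [hjA, hj])]
    have h_union : (A ∪ B) ∪ {j} = A ∪ insert j B := by grind
    rw [h_inter, h_union, hnorm] at h
    rw [Finset.sum_insert hj]
    linarith [ih hAB]

theorem submodular_sdiff_le_sub_sum_erase {α : Type*} [DecidableEq α]
    {F : Finset α → ℝ}
    (hsub : ∀ X Y : Finset α, F (X ∩ Y) + F (X ∪ Y) ≤ F X + F Y)
    {X T : Finset α} (hT : T ⊆ X) :
    F (X \ T) ≤ F X - ∑ j ∈ T, (F X - F (X.erase j)) := by
  induction T using Finset.induction_on with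
  | empty => simp
  | insert j T hj ih =>
    obtain ⟨hjX, hT⟩ := Finset.insert_subset_iff.mp hT
    have h := hsub (X.erase j) (X \ T)
    have h_inter : X.erase j ∩ (X \ T) = X \ insert j T := by grind
    have h_union : X.erase j ∪ (X \ T) = X := by grind
    rw [h_inter, h_union] at h
    rw [Finset.sum_insert hj]
    linarith [ih hT]

/-- Proposition 2, shrink supergradient. -/
theorem shrink_supergradient
    (N : ℕ)
    (F : Finset (Fin N) → ℝ)
    (hnorm : F ∅ = 0)
    (hsub : ∀ X Y : Finset (Fin N), F (X ∩ Y) + F (X ∪ Y) ≤ F X + F Y)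
    (X : Finset (Fin N))
    (s : Fin N → ℝ)
    (hs : ∀ j : Fin N,
      s j = if j ∈ X then F X - F (X.erase j) else F {j}) :
    ∀ Y : Finset (Fin N),
      F Y ≤ F X + (∑ i ∈ Y, s i) - (∑ i ∈ X, s i) := by
  intro Y
  have h_add := submodular_union_le_add_sum_singleton hnorm hsub
    (A := X ∩ Y) (B := Y \ X) (Finset.disjoint_left.mpr (by grind))
  have h_del := submodular_sdiff_le_sub_sum_erase hsub (Finset.sdiff_subset (s := X) (t := Y))
  have h_union : X ∩ Y ∪ Y \ X = Y := by grind
  have h_sdiff : X \ (X \ Y) = X ∩ Y := by grind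
  rw [h_union] at h_add
  rw [h_sdiff] at h_del
  have h_out : ∑ j ∈ Y \ X, s j = ∑ j ∈ Y \ X, F {j} :=
    Finset.sum_congr rfl fun j hj => by rw [hs, if_neg (Finset.mem_sdiff.mp hj).2]
  have h_in : ∑ j ∈ X \ Y, s j = ∑ j ∈ X \ Y, (F X - F (X.erase j)) :=
    Finset.sum_congr rfl fun j hj => by rw [hs, if_pos (Finset.mem_sdiff.mp hj).1]
  have h_split := Finset.sum_sdiff_sub_sum_sdiff (s₁ := X) (s₂ := Y) (f := s)
  linarith
end

section
/- Let F : 2^[N] → ℝ be a normalized submodular set function. For each i ∈ [N] define m_i = log(1 + exp(−(F([N]) − F([N] \ {i})))) − log(1 + exp(F({i}))). For X ⊆ [N], let s̄_X be the bar supergradient of F at X, i.e., the modular function with weights b_i = F([N]) − F([N] \ {i}) for i ∈ X and b_i = F({i}) for i ∉ X, and define Z'_X(s̄_X) = Σ_{Y ⊆ [N]} exp(s̄_X(Y) + F(X) − s̄_X(X)). Then log Z'_X(s̄_X) = F(X) + Σ_{i∈X} m_i + Σ_{i=1}^N log(1 + exp(F({i}))). In particular, since the last sum does not depend on X, minimizing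 log Z'_X(s̄_X) over X ⊆ [N] is equivalent to minimizing F(X) + Σ_{i∈X} m_i over X ⊆ [N]. -/
/-- The softplus function satisfies `log (1 + exp x) = log (1 + exp (-x)) + x`. -/
theorem Real.log_one_add_exp_eq_log_one_add_exp_neg_add (x : ℝ) :
    Real.log (1 + Real.exp x) = Real.log (1 + Real.exp (-x)) + x := by
  have h : 1 + Real.exp x = (1 + Real.exp (-x)) * Real.exp x := by
    rw [add_mul, ← Real.exp_add]
    simp [add_comm]
  rw [h, Real.log_mul (by positivity) (by positivity), Real.log_exp]

/-- The log-partition function of a modular set function with weights `b`, shifted by `c`. -/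
theorem Real.log_sum_exp_sum_add {ι : Type*} [Fintype ι] (b : ι → ℝ) (c : ℝ) :
    Real.log (∑ Y : Finset ι, Real.exp ((∑ i ∈ Y, b i) + c))
      = (∑ i, Real.log (1 + Real.exp (b i))) + c := by
  classical
  have h : ∑ Y : Finset ι, Real.exp ((∑ i ∈ Y, b i) + c)
      = (∏ i, (1 + Real.exp (b i))) * Real.exp c := by
    simp only [Finset.prod_one_add, Finset.powerset_univ, Finset.sum_mul, Real.exp_add,
      Real.exp_sum]
  have hpos : ∀ i, 1 + Real.exp (b i) ≠ 0 := fun i => by positivity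
  rw [h, Real.log_mul (Finset.prod_ne_zero_iff.mpr fun i _ => hpos i) (Real.exp_ne_zero c),
    Real.log_prod fun i _ => hpos i, Real.log_exp]

/-- Log-partition function of the bar supergradient decomposes as
`F X + ∑_{i ∈ X} m i` plus a constant independent of `X`. -/
theorem bar_supergradient_log_partition
    (N : ℕ)
    (F : Finset (Fin N) → ℝ)
    (hnorm : F ∅ = 0)
    (hsub : ∀ X Y : Finset (Fin N), F (X ∩ Y) + F (X ∪ Y) ≤ F X + F Y)
    (X : Finset (Fin N))
    (m : Fin N → ℝ)
    (hm : ∀ i : Fin N,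
      m i = Real.log (1 + Real.exp (-(F Finset.univ - F (Finset.univ.erase i))))
            - Real.log (1 + Real.exp (F {i})))
    (b : Fin N → ℝ)
    (hb : ∀ i : Fin N,
      b i = if i ∈ X then F Finset.univ - F (Finset.univ.erase i) else F {i}) :
    Real.log (∑ Y : Finset (Fin N),
        Real.exp ((∑ i ∈ Y, b i) + F X - ∑ i ∈ X, b i))
      = F X + (∑ i ∈ X, m i) + ∑ i : Fin N, Real.log (1 + Real.exp (F {i})) := by
  have hterm : ∀ i, Real.log (1 + Real.exp (b i))
      = (if i ∈ X then m i + b i else 0) + Real.log (1 + Real.exp (F {i})) := by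
    intro i
    by_cases hi : i ∈ X
    · have hbi := hb i
      rw [if_pos hi] at hbi
      rw [if_pos hi, hm i, ← hbi, Real.log_one_add_exp_eq_log_one_add_exp_neg_add (b i)]
      ring
    · rw [hb i, if_neg hi, if_neg hi, zero_add]
  simp only [add_sub_assoc]
  rw [Real.log_sum_exp_sum_add, Finset.sum_congr rfl fun i _ => hterm i,
    Finset.sum_add_distrib, Finset.sum_ite_mem, Finset.univ_inter, Finset.sum_add_distrib]
  ring
end
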